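/- arXiv:1109.5492 — 2 statements merged into one kernel-verified Lean document; each statement's English description precedes it below -/
import Mathlib

section
/- The function Θ(κ) = √(1+κ²) + ln(κ/(1+√(1+κ²))) on (0,∞) has exactly one zero a; moreover Θ(κ) < 0 for 0 < κ < a and Θ(κ) > 0 for κ > a, and a = √(t_0² − 1), where t_0 is the unique real number t > 1 satisfying coth(t) = t. -/
open MeasureTheory

noncomputable section

/-- Modified Bessel function of the second kind of integer order `n`, for real argument. -/
def besselK (n : ℕ) (x : ℝ) : ℝ :=
  ∫ t in Set.Ioi (0:ℝ), Real.exp (-x * Real.cosh t) * Real.cosh (n * t)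

/-- Modified Bessel function of the first kind of integer order `n`. -/
def besselI (n : ℕ) (x : ℝ) : ℝ :=
  ∑' k : ℕ, (x/2)^(n+2*k) / (Nat.factorial k * Nat.factorial (n+k))

/-- `M_n = n` for even `n`, `n-1` for odd `n`. -/
def Mn (n : ℕ) : ℕ := if Even n then n else n - 1

/-- The half-integer-order modified Bessel function `K_{n+1/2}` on the slit plane,
using the principal branch of the square root. -/
def Khalf (n : ℕ) (z : ℂ) : ℂ :=
  ((Real.pi : ℂ) / (2*z)) ^ ((1:ℂ)/2) * Complex.exp (-z) *
    ∑ k ∈ Finset.range (n+1),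
      ((n+k).factorial : ℂ) / ((k.factorial : ℂ) * ((n-k).factorial : ℂ) * (2*z)^k)

/-- The polynomial `p_n(z) = Σ_{k=0}^n [(n+k)!/(k!(n-k)!)] (2z)^{n-k}`. -/
def pPoly (n : ℕ) : Polynomial ℂ :=
  ∑ k ∈ Finset.range (n+1),
    Polynomial.C (((n+k).factorial : ℂ) / ((k.factorial : ℂ) * ((n-k).factorial : ℂ)))
      * (2 • Polynomial.X) ^ (n-k)

/-- Modified spherical Bessel function `k_n(z) = √(2/(π z)) K_{n+1/2}(z)`. -/
def sphk (n : ℕ) (z : ℂ) : ℂ := ((2:ℂ)/((Real.pi : ℂ) * z)) ^ ((1:ℂ)/2) * Khalf n z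

/-- Laplace transform. -/
def laplace (f : ℝ → ℂ) (s : ℂ) : ℂ := ∫ t in Set.Ioi (0:ℝ), Complex.exp (-s * t) * f t

/-- Convolution on `[0,∞)`. -/
def conv (f g : ℝ → ℂ) (t : ℝ) : ℂ := ∫ τ in (0:ℝ)..t, f (t - τ) * g τ

/-- The 3-D nonreflecting boundary kernel `σ_{n+1/2}` built from the roots `Z` of `p_n`. -/
def sigma3 {n : ℕ} (b c : ℝ) (Z : Fin n → ℂ) (t : ℝ) : ℂ :=
  ((c:ℂ)/(b:ℂ)^2) * ∑ j, Z j * Complex.exp ((c:ℂ) * t * Z j / b)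

/-- The 3-D nonreflecting boundary kernel `ω_{n+1/2}` built from the roots `Z` of `p_n`. -/
def omega3 {n : ℕ} (b c : ℝ) (Z : Fin n → ℂ) (t : ℝ) : ℂ :=
  -(c:ℂ)/b + ((c:ℂ)/b) * ∑ j, (Complex.exp ((c:ℂ) * t * Z j / b) - 1)

/-- The 2-D nonreflecting boundary kernel `σ_n`, built from the zeros `Z` of (the analytic
continuation of) `K_n`. -/
def sigma2 (n : ℕ) (b c : ℝ) {m : ℕ} (Z : Fin m → ℂ) (t : ℝ) : ℂ :=
  ((c:ℂ)/(b:ℂ)^2) * (∑ j, Z j * Complex.exp ((c:ℂ) * t * Z j / b)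
    + (-1:ℂ)^n * ((∫ r in Set.Ioi (0:ℝ),
        Real.exp (-c*t*r/b) / ((besselK n r)^2 + Real.pi^2 * (besselI n r)^2) : ℝ) : ℂ))

/-- The 2-D nonreflecting boundary kernel `ω_n`. -/
def omega2 (n : ℕ) (b c : ℝ) {m : ℕ} (Z : Fin m → ℂ) (t : ℝ) : ℂ :=
  -(c:ℂ)/(2*b) + ((c:ℂ)/b) * (∑ j, (Complex.exp ((c:ℂ) * t * Z j / b) - 1)
    + (-1:ℂ)^n * ((∫ r in Set.Ioi (0:ℝ),
        (1 - Real.exp (-c*t*r/b)) / (r * ((besselK n r)^2 + Real.pi^2 * (besselI n r)^2)) : ℝ) : ℂ))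

end

/-- The function `Θ` expressed in the variable `t = √(1+κ²)`. -/
noncomputable def thetaSubst (t : ℝ) : ℝ := t + (Real.log (t - 1) - Real.log (t + 1)) / 2

theorem one_lt_sqrt_one_add_sq {κ : ℝ} (hκ : 0 < κ) : 1 < Real.sqrt (1 + κ ^ 2) := by
  rw [Real.lt_sqrt zero_le_one]
  nlinarith [pow_pos hκ 2]

theorem sqrt_one_add_sq_lt_iff {a b : ℝ} (ha : 0 < a) (hb : 0 < b) :
    Real.sqrt (1 + a ^ 2) < Real.sqrt (1 + b ^ 2) ↔ a < b := by
  rw [Real.sqrt_lt_sqrt_iff (by positivity), add_lt_add_iff_left,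
    pow_lt_pow_iff_left₀ ha.le hb.le two_ne_zero]

theorem thetaSubst_sqrt_one_add_sq {κ : ℝ} (hκ : 0 < κ) :
    Real.sqrt (1 + κ ^ 2) + Real.log (κ / (1 + Real.sqrt (1 + κ ^ 2))) =
      thetaSubst (Real.sqrt (1 + κ ^ 2)) := by
  have ht := one_lt_sqrt_one_add_sq hκ
  have hsq : Real.sqrt (1 + κ ^ 2) ^ 2 = 1 + κ ^ 2 := Real.sq_sqrt (by positivity)
  generalize Real.sqrt (1 + κ ^ 2) = t at ht hsq
  have hlog : 2 * Real.log κ = Real.log (t - 1) + Real.log (t + 1) := by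
    rw [← Real.log_mul (by linarith) (by linarith),
      show (t - 1) * (t + 1) = κ ^ 2 by linear_combination hsq, Real.log_pow]
    norm_num
  rw [thetaSubst, Real.log_div hκ.ne' (by linarith), add_comm 1 t]
  linear_combination hlog / 2

theorem strictMonoOn_thetaSubst : StrictMonoOn thetaSubst (Set.Ioi 1) := by
  intro s hs t ht hst
  rw [Set.mem_Ioi] at hs ht
  have h : Real.log ((s - 1) * (t + 1)) < Real.log ((t - 1) * (s + 1)) :=
    Real.log_lt_log (mul_pos (by linarith) (by linarith)) (by nlinarith)
  rw [Real.log_mul (by linarith) (by linarith), Real.log_mul (by linarith) (by linarith)] at h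
  unfold thetaSubst
  linarith

theorem thetaSubst_eq_zero_iff {t : ℝ} (ht : 1 < t) :
    thetaSubst t = 0 ↔ Real.cosh t / Real.sinh t = t := by
  have hsinh : Real.sinh t ≠ 0 := (Real.sinh_pos_iff.2 (by linarith)).ne'
  have hexp : Real.cosh t / Real.sinh t = t ↔
      (t - 1) * Real.exp t = (t + 1) * Real.exp (-t) := by
    rw [div_eq_iff hsinh, Real.cosh_eq, Real.sinh_eq]
    constructor <;> intro h <;> linarith
  have hpos : 0 < t - 1 := by linarith
  have hpos' : 0 < t + 1 := by linarith
  rw [hexp, ← Real.log_injOn_pos.eq_iff (Set.mem_Ioi.2 (mul_pos hpos (Real.exp_pos t)))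
      (Set.mem_Ioi.2 (mul_pos hpos' (Real.exp_pos (-t)))),
    Real.log_mul hpos.ne' (Real.exp_ne_zero _), Real.log_mul hpos'.ne' (Real.exp_ne_zero _),
    Real.log_exp, Real.log_exp, thetaSubst]
  constructor <;> intro h <;> linarith

theorem exists_thetaSubst_eq_zero : ∃ t, 1 < t ∧ thetaSubst t = 0 := by
  have hε : 0 < Real.exp (-4) := Real.exp_pos _
  have hε' : Real.exp (-4) < 1 := Real.exp_lt_one_iff.2 (by norm_num)
  have hcont : ContinuousOn thetaSubst (Set.Icc (1 + Real.exp (-4)) 2) := by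
    unfold thetaSubst
    refine continuousOn_id.add (ContinuousOn.div_const (ContinuousOn.sub ?_ ?_) 2)
    · exact ContinuousOn.log (by fun_prop) fun x hx => by linarith [hx.1]
    · exact ContinuousOn.log (by fun_prop) fun x hx => by linarith [hx.1]
  have hleft : thetaSubst (1 + Real.exp (-4)) ≤ 0 := by
    have hlog : 0 ≤ Real.log (1 + Real.exp (-4) + 1) := Real.log_nonneg (by linarith)
    rw [thetaSubst, add_sub_cancel_left, Real.log_exp]
    linarith
  have hright : 0 ≤ thetaSubst 2 := by
    have h := Real.log_le_sub_one_of_pos (show (0 : ℝ) < 3 by norm_num)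
    rw [thetaSubst, show (2 : ℝ) - 1 = 1 by norm_num, show (2 : ℝ) + 1 = 3 by norm_num, Real.log_one]
    linarith
  obtain ⟨t, ht, h⟩ := intermediate_value_Icc (by linarith) hcont ⟨hleft, hright⟩
  exact ⟨t, by linarith [ht.1], h⟩

/-- `Θ(κ) = √(1+κ²) + ln(κ/(1+√(1+κ²)))` has exactly one zero `a` on `(0,∞)`,
is negative before it and positive after it, and `a = √(t₀²−1)` where `t₀` is the unique
`t > 1` with `coth t = t`. -/
theorem stmt_7 :
    (∃! t0 : ℝ, 1 < t0 ∧ Real.cosh t0 / Real.sinh t0 = t0) ∧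
    (∃! a : ℝ, 0 < a ∧
      Real.sqrt (1+a^2) + Real.log (a / (1 + Real.sqrt (1+a^2))) = 0) ∧
    (∀ a : ℝ, 0 < a →
      Real.sqrt (1+a^2) + Real.log (a / (1 + Real.sqrt (1+a^2))) = 0 →
      (∀ κ : ℝ, 0 < κ → κ < a →
        Real.sqrt (1+κ^2) + Real.log (κ / (1 + Real.sqrt (1+κ^2))) < 0) ∧
      (∀ κ : ℝ, a < κ →
        0 < Real.sqrt (1+κ^2) + Real.log (κ / (1 + Real.sqrt (1+κ^2)))) ∧
      (∀ t0 : ℝ, 1 < t0 → Real.cosh t0 / Real.sinh t0 = t0 →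
        a = Real.sqrt (t0^2 - 1))) := by
  obtain ⟨t, ht, hzero⟩ := exists_thetaSubst_eq_zero
  have hinj := strictMonoOn_thetaSubst.injOn
  have hκ : 0 < Real.sqrt (t ^ 2 - 1) := Real.sqrt_pos.2 (by nlinarith)
  have hsqrt : Real.sqrt (1 + Real.sqrt (t ^ 2 - 1) ^ 2) = t := by
    rw [Real.sq_sqrt (by nlinarith), add_sub_cancel, Real.sqrt_sq (by linarith)]
  have heq : ∀ a : ℝ, 0 < a →
      Real.sqrt (1 + a ^ 2) + Real.log (a / (1 + Real.sqrt (1 + a ^ 2))) = 0 →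
      Real.sqrt (1 + a ^ 2) = t := by
    intro a ha h
    rw [thetaSubst_sqrt_one_add_sq ha] at h
    exact hinj (one_lt_sqrt_one_add_sq ha) ht (h.trans hzero.symm)
  have heq' : ∀ a : ℝ, 0 < a →
      Real.sqrt (1 + a ^ 2) + Real.log (a / (1 + Real.sqrt (1 + a ^ 2))) = 0 →
      a = Real.sqrt (t ^ 2 - 1) := by
    intro a ha h
    rw [← heq a ha h, Real.sq_sqrt (by positivity), add_sub_cancel_left, Real.sqrt_sq ha.le]
  have huniq : ∀ s : ℝ, 1 < s → Real.cosh s / Real.sinh s = s → s = t := fun s hs h =>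
    hinj hs ht (((thetaSubst_eq_zero_iff hs).2 h).trans hzero.symm)
  refine ⟨⟨t, ⟨ht, (thetaSubst_eq_zero_iff ht).1 hzero⟩, fun s hs => huniq s hs.1 hs.2⟩,
    ⟨Real.sqrt (t ^ 2 - 1), ⟨hκ, ?_⟩, fun a ha => heq' a ha.1 ha.2⟩,
    fun a ha h => ⟨fun κ hκ hlt => ?_, fun κ hlt => ?_, fun s hs hcoth => ?_⟩⟩
  · rw [thetaSubst_sqrt_one_add_sq hκ, hsqrt, hzero]
  · rw [← h, thetaSubst_sqrt_one_add_sq hκ, thetaSubst_sqrt_one_add_sq ha]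
    exact strictMonoOn_thetaSubst (one_lt_sqrt_one_add_sq hκ) (one_lt_sqrt_one_add_sq ha)
      ((sqrt_one_add_sq_lt_iff hκ ha).2 hlt)
  · have hκ := ha.trans hlt
    rw [← h, thetaSubst_sqrt_one_add_sq hκ, thetaSubst_sqrt_one_add_sq ha]
    exact strictMonoOn_thetaSubst (one_lt_sqrt_one_add_sq ha) (one_lt_sqrt_one_add_sq hκ)
      ((sqrt_one_add_sq_lt_iff ha hκ).2 hlt)
  · rw [huniq s hs hcoth]
    exact heq' a ha h
end

section
/- Let n ≥ 0 be an integer. Then for every z ∈ ℂ with Re(z) > 0 (where k_n(z) ≠ 0), one has both Re( z · k_n'(z)/k_n(z) ) ≤ 0 and Re( k_n'(z)/k_n(z) ) ≤ 0. -/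
open MeasureTheory

open Filter Topology Bornology

/-- The reverse Bessel polynomials `θ_n`, through their three-term recurrence. -/
noncomputable def reverseBessel : ℕ → ℂ → ℂ
  | 0, _ => 1
  | 1, z => 1 + z
  | n + 2, z => (2 * n + 3) * reverseBessel (n + 1) z + z ^ 2 * reverseBessel n z

/-- The scaled ratio `z k_{n-1}(z) / k_n(z)`, as a continued fraction. -/
noncomputable def besselRatio : ℕ → ℂ → ℂ
  | 0, z => z
  | n + 1, z => z ^ 2 / (besselRatio n z + (2 * n + 1))

/-- The polynomials `P_n` with `|θ_n(iy)|² = P_n(y²)`. -/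
noncomputable def modulusPoly : ℕ → Polynomial ℝ
  | 0 => 1
  | 1 => 1 + Polynomial.X
  | n + 2 => Polynomial.C ((2 * n + 3 : ℝ) ^ 2) * modulusPoly (n + 1)
      - Polynomial.C (2 * (2 * n + 3 : ℝ)) * (Polynomial.X * (modulusPoly (n + 1)).derivative)
      + Polynomial.X ^ 2 * modulusPoly n

theorem besselRatio_zero (n : ℕ) : besselRatio n 0 = 0 := by
  cases n <;> simp [besselRatio]

theorem re_besselRatio_div_pos (n : ℕ) {z : ℂ} (hz : 0 ≤ z.re) (h0 : z ≠ 0) :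
    0 < (besselRatio n z / z).re := by
  induction n with
  | zero => simp [besselRatio, h0]
  | succ n ih =>
    have key : besselRatio (n + 1) z / z = (besselRatio n z / z + ((2 * n + 1 : ℝ) : ℂ) * z⁻¹)⁻¹ := by
      rw [besselRatio]
      push_cast
      rw [← div_eq_mul_inv, ← add_div, inv_div]
      field_simp
    have hpos : 0 < (besselRatio n z / z + ((2 * n + 1 : ℝ) : ℂ) * z⁻¹).re := by
      rw [Complex.add_re, Complex.re_ofReal_mul, Complex.inv_re]
      have := Complex.normSq_nonneg z
      positivity
    rw [key, Complex.inv_re]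
    refine div_pos hpos (Complex.normSq_pos.2 fun h => ?_)
    rw [h, Complex.zero_re] at hpos
    exact hpos.false

theorem besselRatio_add_ne_zero (n : ℕ) {z : ℂ} (hz : 0 ≤ z.re) :
    besselRatio n z + (2 * n + 1) ≠ 0 := by
  rcases eq_or_ne z 0 with rfl | h0
  · rw [besselRatio_zero, zero_add]
    exact_mod_cast Nat.succ_ne_zero (2 * n)
  · intro h
    have h1 := re_besselRatio_div_pos n hz h0
    have h2 : besselRatio n z / z = -(((2 * n + 1 : ℝ) : ℂ) * z⁻¹) := by
      rw [eq_neg_of_add_eq_zero_left h]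
      push_cast
      ring
    rw [h2, Complex.neg_re, Complex.re_ofReal_mul, Complex.inv_re] at h1
    have : 0 ≤ (2 * n + 1 : ℝ) * (z.re / Complex.normSq z) := by
      have := Complex.normSq_nonneg z
      positivity
    linarith

theorem differentiableAt_besselRatio (n : ℕ) {z : ℂ} (hz : 0 ≤ z.re) :
    DifferentiableAt ℂ (besselRatio n) z := by
  induction n with
  | zero => exact differentiableAt_id
  | succ n ih =>
    exact (differentiableAt_id.pow 2).div (ih.add_const _) (besselRatio_add_ne_zero n hz)

theorem tendsto_besselRatio_div (n : ℕ) :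
    Tendsto (fun z => besselRatio n z / z) (cobounded ℂ) (𝓝 1) := by
  have hne : ∀ᶠ z : ℂ in cobounded ℂ, z ≠ 0 := eventually_ne_cobounded 0
  induction n with
  | zero =>
    refine tendsto_const_nhds.congr' ?_
    filter_upwards [hne] with z hz
    simp [besselRatio, hz]
  | succ n ih =>
    have h : Tendsto (fun z : ℂ => (besselRatio n z / z + (2 * n + 1) * z⁻¹)⁻¹)
        (cobounded ℂ) (𝓝 1) := by
      have := (ih.add ((tendsto_inv₀_cobounded (α := ℂ)).const_mul (2 * n + 1 : ℂ))).inv₀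
        (by simp)
      simpa using this
    refine h.congr' ?_
    filter_upwards [hne] with z hz
    rw [besselRatio, ← div_eq_mul_inv, ← add_div, inv_div]
    field_simp

theorem exists_besselRatio_ofReal (n : ℕ) {x : ℝ} (hx : 0 ≤ x) :
    ∃ r : ℝ, 0 ≤ r ∧ besselRatio n x = r := by
  induction n with
  | zero => exact ⟨x, hx, rfl⟩
  | succ n ih =>
    obtain ⟨r, hr, h⟩ := ih
    refine ⟨x ^ 2 / (r + (2 * n + 1)), by positivity, ?_⟩
    rw [besselRatio, h]
    push_cast
    rfl

theorem reverseBessel_succ (n : ℕ) {z : ℂ} (hz : 0 ≤ z.re) :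
    reverseBessel (n + 1) z = reverseBessel n z * (besselRatio n z + (2 * n + 1)) := by
  induction n with
  | zero => simp [reverseBessel, besselRatio, add_comm]
  | succ n ih =>
    have h := besselRatio_add_ne_zero n hz
    rw [reverseBessel, besselRatio, ih]
    push_cast
    field_simp
    ring

theorem besselRatio_mul_reverseBessel (n : ℕ) {z : ℂ} (hz : 0 ≤ z.re) :
    besselRatio (n + 1) z * reverseBessel (n + 1) z = z ^ 2 * reverseBessel n z := by
  have h := besselRatio_add_ne_zero n hz
  rw [reverseBessel_succ n hz, besselRatio]
  field_simp

theorem reverseBessel_ne_zero (n : ℕ) {z : ℂ} (hz : 0 ≤ z.re) : reverseBessel n z ≠ 0 := by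
  induction n with
  | zero => simp [reverseBessel]
  | succ n ih =>
    rw [reverseBessel_succ n hz]
    exact mul_ne_zero ih (besselRatio_add_ne_zero n hz)

theorem hasDerivAt_reverseBessel_succ (n : ℕ) (z : ℂ) :
    HasDerivAt (reverseBessel (n + 1))
      (reverseBessel (n + 1) z - z * reverseBessel n z) z := by
  induction n using Nat.twoStepInduction with
  | zero =>
    have h := (hasDerivAt_id z).const_add (1 : ℂ)
    refine h.congr_deriv ?_
    simp [reverseBessel]
  | one =>
    have h := (((hasDerivAt_id z).const_add (1 : ℂ)).const_mul (3 : ℂ)).add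
      ((hasDerivAt_id z).pow 2)
    have hf : reverseBessel (1 + 1) = (fun y => 3 * (1 + id y)) + id ^ 2 := by
      funext w
      simp [reverseBessel]
    rw [hf]
    refine h.congr_deriv ?_
    simp [reverseBessel]
    ring
  | more n ih1 ih2 =>
    have h := (ih2.const_mul (2 * (n + 1 : ℕ) + 3 : ℂ)).add (((hasDerivAt_id z).pow 2).mul ih1)
    refine h.congr_deriv ?_
    simp only [reverseBessel, id, Pi.pow_apply]
    push_cast
    ring

theorem hasDerivAt_reverseBessel (n : ℕ) {z : ℂ} (hz : 0 ≤ z.re) (h0 : z ≠ 0) :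
    HasDerivAt (reverseBessel n) ((1 - besselRatio n z / z) * reverseBessel n z) z := by
  cases n with
  | zero =>
    refine (hasDerivAt_const z (1 : ℂ)).congr_deriv ?_
    simp [besselRatio, h0]
  | succ n =>
    refine (hasDerivAt_reverseBessel_succ n z).congr_deriv ?_
    rw [sub_mul, one_mul, div_mul_eq_mul_div, besselRatio_mul_reverseBessel n hz]
    field_simp

theorem modulusPoly_coeff (n : ℕ) :
    (∀ k, 0 ≤ (modulusPoly n).coeff k) ∧ (modulusPoly n).natDegree ≤ n := by
  induction n using Nat.twoStepInduction with
  | zero =>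
    refine ⟨fun k => ?_, by simp [modulusPoly]⟩
    rw [modulusPoly, Polynomial.coeff_one]
    positivity
  | one =>
    refine ⟨fun k => ?_, ?_⟩
    · rw [modulusPoly, Polynomial.coeff_add, Polynomial.coeff_one, Polynomial.coeff_X]
      positivity
    · rw [modulusPoly]
      compute_degree
  | more n ih1 ih2 =>
    have hc : ∀ k, (modulusPoly (n + 2)).coeff k
        = (2 * n + 3) * (2 * n + 3 - 2 * k) * (modulusPoly (n + 1)).coeff k
          + (Polynomial.X ^ 2 * modulusPoly n).coeff k := by
      intro k
      rw [modulusPoly, Polynomial.coeff_add, Polynomial.coeff_sub, Polynomial.coeff_C_mul,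
        Polynomial.coeff_C_mul]
      congr 1
      cases k with
      | zero =>
        rw [Polynomial.coeff_X_mul_zero]
        push_cast
        ring
      | succ k =>
        rw [Polynomial.coeff_X_mul, Polynomial.coeff_derivative]
        push_cast
        ring
    constructor
    · intro k
      rw [hc]
      refine add_nonneg ?_ ?_
      · rcases le_or_gt k (n + 1) with hk | hk
        · have : (k : ℝ) ≤ n + 1 := by exact_mod_cast hk
          exact mul_nonneg (mul_nonneg (by positivity) (by linarith)) (ih2.1 k)
        · rw [Polynomial.coeff_eq_zero_of_natDegree_lt (ih2.2.trans_lt hk), mul_zero]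
      · rw [Polynomial.coeff_X_pow_mul']
        split_ifs
        · exact ih1.1 _
        · exact le_rfl
    · rw [Polynomial.natDegree_le_iff_coeff_eq_zero]
      intro k hk
      rw [hc, Polynomial.coeff_eq_zero_of_natDegree_lt (ih2.2.trans_lt (by omega)),
        Polynomial.coeff_X_pow_mul']
      split_ifs
      · rw [Polynomial.coeff_eq_zero_of_natDegree_lt (ih1.2.trans_lt (by omega))]
        simp
      · simp

theorem mul_eval_derivative_le {p : Polynomial ℝ} {n : ℕ} (hp : ∀ k, 0 ≤ p.coeff k)
    (hn : p.natDegree ≤ n) {t : ℝ} (ht : 0 ≤ t) :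
    t * p.derivative.eval t ≤ n * p.eval t := by
  have h : t * p.derivative.eval t = (Polynomial.X * p.derivative).eval t := by simp
  have hd : (Polynomial.X * p.derivative).natDegree < n + 1 := by
    rw [Nat.lt_succ_iff, Polynomial.natDegree_le_iff_coeff_eq_zero]
    intro k hk
    cases k with
    | zero => simp
    | succ k =>
      rw [Polynomial.coeff_X_mul, Polynomial.coeff_derivative,
        Polynomial.coeff_eq_zero_of_natDegree_lt (hn.trans_lt hk), zero_mul]
  rw [h, Polynomial.eval_eq_sum_range' hd, Polynomial.eval_eq_sum_range' (Nat.lt_succ_of_le hn),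
    Finset.mul_sum]
  refine Finset.sum_le_sum fun k hk => ?_
  have hk' : (k : ℝ) ≤ n := by exact_mod_cast Finset.mem_range_succ_iff.1 hk
  have hc : (Polynomial.X * p.derivative).coeff k = k * p.coeff k := by
    cases k with
    | zero => simp
    | succ k =>
      rw [Polynomial.coeff_X_mul, Polynomial.coeff_derivative]
      push_cast
      ring
  rw [hc, mul_assoc]
  exact mul_le_mul_of_nonneg_right hk' (mul_nonneg (hp k) (pow_nonneg ht k))

theorem hasDerivAt_normSq_reverseBessel (n : ℕ) {y : ℝ} (hy : y ≠ 0) :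
    HasDerivAt (fun u : ℝ => Complex.normSq (reverseBessel n (u * Complex.I)))
      (-2 * (besselRatio n (y * Complex.I)).re / y
        * Complex.normSq (reverseBessel n (y * Complex.I))) y := by
  have hI : (y : ℂ) * Complex.I ≠ 0 := by simp [hy]
  have hg : HasDerivAt (fun u : ℝ => (u : ℂ) * Complex.I) Complex.I y := by
    simpa using (Complex.ofRealCLM.hasDerivAt (x := y)).mul_const Complex.I
  have h := (hasDerivAt_reverseBessel n (by simp) hI).comp y hg
  set w := reverseBessel n (y * Complex.I)
  set s := besselRatio n (y * Complex.I)
  have hre := (Complex.reCLM.hasFDerivAt.comp_hasDerivAt y h)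
  have him := (Complex.imCLM.hasFDerivAt.comp_hasDerivAt y h)
  have := (hre.mul hre).add (him.mul him)
  refine (this.congr_deriv ?_)
  have hd : (1 - s / (y * Complex.I)) * w * Complex.I
      = (Complex.I - ((y⁻¹ : ℝ) : ℂ) * s) * w := by
    have hy' : (y : ℂ) ≠ 0 := by exact_mod_cast hy
    push_cast
    field_simp
  simp only [Function.comp_apply, Complex.reCLM_apply, Complex.imCLM_apply]
  rw [hd, Complex.normSq_apply]
  simp only [Complex.mul_re, Complex.mul_im, Complex.sub_re, Complex.sub_im, Complex.I_re,
    Complex.I_im, Complex.ofReal_re, Complex.ofReal_im]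
  ring

theorem re_besselRatio_mul_normSq (n : ℕ)
    (h : ∀ y : ℝ, Complex.normSq (reverseBessel n (y * Complex.I))
      = (modulusPoly n).eval (y ^ 2)) (y : ℝ) :
    (besselRatio n (y * Complex.I)).re * Complex.normSq (reverseBessel n (y * Complex.I))
      = -(y ^ 2 * (modulusPoly n).derivative.eval (y ^ 2)) := by
  rcases eq_or_ne y 0 with rfl | hy
  · simp [besselRatio_zero]
  have h1 := hasDerivAt_normSq_reverseBessel n hy
  have h2 := ((modulusPoly n).hasDerivAt (y ^ 2)).comp y (hasDerivAt_pow 2 y)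
  have h3 := h1.unique (h2.congr_of_eventuallyEq (Eventually.of_forall h))
  field_simp at h3
  push_cast at h3
  simp only [pow_one] at h3
  linarith

theorem normSq_reverseBessel (n : ℕ) (y : ℝ) :
    Complex.normSq (reverseBessel n (y * Complex.I)) = (modulusPoly n).eval (y ^ 2) := by
  induction n using Nat.twoStepInduction generalizing y with
  | zero => simp [reverseBessel, modulusPoly]
  | one =>
    simp [reverseBessel, modulusPoly, Complex.normSq_apply]
    ring
  | more n ih1 ih2 =>
    have h := re_besselRatio_mul_normSq (n + 1) ih2 y
    have hs : reverseBessel (n + 2) (y * Complex.I)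
        = ((2 * n + 3 : ℝ) : ℂ) * reverseBessel (n + 1) (y * Complex.I)
          + ((-y ^ 2 : ℝ) : ℂ) * reverseBessel n (y * Complex.I) := by
      rw [reverseBessel, mul_pow, Complex.I_sq]
      push_cast
      ring
    have hb := besselRatio_mul_reverseBessel n (z := y * Complex.I) (by simp)
    rw [mul_pow, Complex.I_sq] at hb
    have hm : (besselRatio (n + 1) (y * Complex.I)).re
        * Complex.normSq (reverseBessel (n + 1) (y * Complex.I))
        = -y ^ 2 * (reverseBessel n (y * Complex.I)
          * (starRingEnd ℂ) (reverseBessel (n + 1) (y * Complex.I))).re := by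
      rw [← Complex.re_mul_ofReal, ← Complex.re_ofReal_mul, Complex.normSq_eq_conj_mul_self,
        mul_comm ((starRingEnd ℂ) _), ← mul_assoc, hb]
      push_cast
      ring_nf
    rw [hs]
    simp only [modulusPoly, Polynomial.eval_add, Polynomial.eval_sub, Polynomial.eval_mul,
      Polynomial.eval_C, Polynomial.eval_X, Polynomial.eval_pow]
    rw [← ih1, ← ih2]
    rw [hm] at h
    simp only [Complex.normSq_apply, Complex.mul_re, Complex.mul_im, Complex.add_re,
      Complex.add_im, Complex.ofReal_re, Complex.ofReal_im, Complex.conj_re,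
      Complex.conj_im] at h ⊢
    linear_combination (2 * (2 * n + 3 : ℝ)) * h

theorem neg_le_re_besselRatio_mul_I (n : ℕ) (y : ℝ) :
    -(n : ℝ) ≤ (besselRatio n (y * Complex.I)).re := by
  have h := re_besselRatio_mul_normSq n (normSq_reverseBessel n) y
  have hpos : 0 < Complex.normSq (reverseBessel n (y * Complex.I)) :=
    Complex.normSq_pos.2 (reverseBessel_ne_zero n (by simp))
  have hle := mul_eval_derivative_le (modulusPoly_coeff n).1 (modulusPoly_coeff n).2 (sq_nonneg y)
  rw [← normSq_reverseBessel] at hle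
  refine le_of_mul_le_mul_right ?_ hpos
  linarith

theorem neg_le_re_besselRatio (n : ℕ) {z : ℂ} (hz : 0 ≤ z.re) :
    -(n : ℝ) ≤ (besselRatio n z).re := by
  have key : ‖Complex.exp (-besselRatio n z)‖ ≤ Real.exp n := by
    refine PhragmenLindelof.right_half_plane_of_bounded_on_real
      (f := fun z => Complex.exp (-besselRatio n z)) ?_ ⟨1, one_lt_two, 2, ?_⟩ ?_ ?_ hz
    · refine DifferentiableOn.diffContOnCl fun w hw => ?_
      rw [Complex.closure_setOfPred_lt_re] at hw
      exact (differentiableAt_besselRatio n hw).neg.cexp.differentiableWithinAt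
    · refine Asymptotics.IsBigO.of_bound 1 (Filter.Eventually.filter_mono inf_le_left ?_)
      have h := (tendsto_besselRatio_div n).norm.eventually_le_const
        (show ‖(1 : ℂ)‖ < 2 by simp)
      filter_upwards [h, eventually_ne_cobounded (0 : ℂ)] with w hw hw0
      rw [norm_div, div_le_iff₀ (norm_pos_iff.2 hw0)] at hw
      rw [Complex.norm_exp, Real.norm_of_nonneg (Real.exp_pos _).le, one_mul, Real.rpow_one,
        Real.exp_le_exp]
      exact (Complex.re_le_norm _).trans (by rwa [norm_neg])
    · refine isBoundedUnder_of_eventually_le (a := 1) ?_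
      filter_upwards [eventually_ge_atTop 0] with x hx
      obtain ⟨r, hr, h⟩ := exists_besselRatio_ofReal n hx
      rw [h, Complex.norm_exp]
      simpa using hr
    · intro y
      rw [Complex.norm_exp, Real.exp_le_exp, Complex.neg_re]
      linarith [neg_le_re_besselRatio_mul_I n y]
  rw [Complex.norm_exp, Real.exp_le_exp, Complex.neg_re] at key
  linarith

/-- The coefficients `(n+k)! / (k! (n-k)!)`, extended by zero to `k > n`. -/
noncomputable def besselCoeff (n k : ℕ) : ℂ :=
  if k ≤ n then ((n+k).factorial : ℂ) / ((k.factorial : ℂ) * ((n-k).factorial : ℂ)) else 0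

theorem besselCoeff_zero_right (n : ℕ) : besselCoeff n 0 = 1 := by
  simp [besselCoeff, Nat.factorial_ne_zero]

theorem besselCoeff_recurrence (n k : ℕ) :
    besselCoeff (n + 2) (k + 1)
      = 2 * (2 * n + 3) * besselCoeff (n + 1) k + besselCoeff n (k + 1) := by
  have hf : ∀ m : ℕ, (m.factorial : ℂ) ≠ 0 := fun m => by exact_mod_cast m.factorial_ne_zero
  unfold besselCoeff
  rcases lt_trichotomy k n with h | rfl | h
  · obtain ⟨m, rfl⟩ := Nat.exists_eq_add_of_lt h
    rw [if_pos (by omega), if_pos (by omega), if_pos (by omega),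
      show k + m + 1 + 2 + (k + 1) = (2 * k + m + 2) + 1 + 1 by ring,
      show k + m + 1 + 1 + k = 2 * k + m + 2 by ring,
      show k + m + 1 + (k + 1) = 2 * k + m + 2 by ring,
      show k + m + 1 + 2 - (k + 1) = m + 1 + 1 by omega,
      show k + m + 1 + 1 - k = m + 1 + 1 by omega,
      show k + m + 1 - (k + 1) = m by omega]
    have h1 : (m : ℂ) + 1 ≠ 0 := by exact_mod_cast m.succ_ne_zero
    have h2 : (m : ℂ) + 1 + 1 ≠ 0 := by exact_mod_cast (m + 1).succ_ne_zero
    have h3 : (k : ℂ) + 1 ≠ 0 := by exact_mod_cast k.succ_ne_zero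
    have := hf k
    have := hf m
    simp only [Nat.factorial_succ]
    push_cast
    field_simp
    ring
  · rw [if_pos (by omega), if_pos (by omega), if_neg (by omega),
      show k + 2 + (k + 1) = (2 * k + 1) + 1 + 1 by ring,
      show k + 1 + k = 2 * k + 1 by ring,
      show k + 2 - (k + 1) = 1 by omega,
      show k + 1 - k = 1 by omega]
    have h3 : (k : ℂ) + 1 ≠ 0 := by exact_mod_cast k.succ_ne_zero
    have := hf k
    rw [Nat.factorial_succ (2 * k + 1 + 1), Nat.factorial_succ (2 * k + 1), Nat.factorial_succ k]
    push_cast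
    simp only [Nat.factorial_one, Nat.cast_one]
    field_simp
    ring
  · rcases eq_or_lt_of_le (Nat.succ_le_of_lt h) with rfl | h'
    · rw [if_pos (by omega), if_pos (by omega), if_neg (by omega),
        show n + 2 + (n.succ + 1) = (2 * n + 2) + 1 + 1 by simp; ring,
        show n + 1 + n.succ = 2 * n + 2 by simp; ring,
        show n + 2 - (n.succ + 1) = 0 by omega,
        show n + 1 - n.succ = 0 by omega]
      have h3 : (n : ℂ) + 1 + 1 ≠ 0 := by exact_mod_cast (n + 1).succ_ne_zero
      have := hf n.succ
      rw [Nat.factorial_succ (2 * n + 2 + 1), Nat.factorial_succ (2 * n + 2),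
        Nat.factorial_succ n.succ]
      push_cast
      simp only [Nat.factorial_zero, Nat.cast_one]
      field_simp
      ring
    · rw [if_neg (by omega), if_neg (by omega), if_neg (by omega)]
      simp

theorem sum_besselCoeff_extend (n m : ℕ) (h : n ≤ m) (w : ℂ) :
    ∑ k ∈ Finset.range (n + 1), besselCoeff n k * w ^ k
      = ∑ k ∈ Finset.range (m + 1), besselCoeff n k * w ^ k := by
  refine Finset.sum_subset (Finset.range_mono (by omega)) fun k _ hk => ?_
  rw [besselCoeff, if_neg (by simpa [Nat.lt_succ_iff] using hk), zero_mul]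

theorem sum_besselCoeff_recurrence (n : ℕ) (w : ℂ) :
    ∑ k ∈ Finset.range (n + 3), besselCoeff (n + 2) k * w ^ k
      = 2 * (2 * n + 3) * w * ∑ k ∈ Finset.range (n + 2), besselCoeff (n + 1) k * w ^ k
        + ∑ k ∈ Finset.range (n + 1), besselCoeff n k * w ^ k := by
  rw [sum_besselCoeff_extend n (n + 2) (by omega), Finset.sum_range_succ',
    Finset.sum_range_succ' (fun k => besselCoeff n k * w ^ k), Finset.mul_sum, ← add_assoc,
    ← Finset.sum_add_distrib, besselCoeff_zero_right, besselCoeff_zero_right]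
  congr 1
  refine Finset.sum_congr rfl fun k _ => ?_
  rw [besselCoeff_recurrence]
  ring

theorem pow_mul_sum_besselCoeff (n : ℕ) {z : ℂ} (hz : z ≠ 0) :
    z ^ n * ∑ k ∈ Finset.range (n + 1), besselCoeff n k * ((2 * z)⁻¹) ^ k
      = reverseBessel n z := by
  induction n using Nat.twoStepInduction with
  | zero => simp [besselCoeff, reverseBessel]
  | one =>
    simp [besselCoeff, reverseBessel, Finset.sum_range_succ]
    field_simp
    ring
  | more n ih1 ih2 =>
    rw [sum_besselCoeff_recurrence, reverseBessel, ← ih1, ← ih2]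
    field_simp
    ring

theorem sphk_eq (n : ℕ) {z : ℂ} (hz : 0 < z.re) :
    sphk n z = Complex.exp (-z) * (z ^ (n + 1))⁻¹ * reverseBessel n z := by
  have h0 : z ≠ 0 := by
    rintro rfl
    simp at hz
  have hsum : ∑ k ∈ Finset.range (n+1),
      ((n+k).factorial : ℂ) / ((k.factorial : ℂ) * ((n-k).factorial : ℂ) * (2*z)^k)
      = ∑ k ∈ Finset.range (n + 1), besselCoeff n k * ((2 * z)⁻¹) ^ k := by
    refine Finset.sum_congr rfl fun k hk => ?_
    rw [besselCoeff, if_pos (Finset.mem_range_succ_iff.1 hk), inv_pow, ← div_eq_mul_inv, div_div]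
  have hroot : ((2:ℂ)/((Real.pi : ℂ) * z)) ^ ((1:ℂ)/2) * ((Real.pi : ℂ) / (2*z)) ^ ((1:ℂ)/2)
      = z⁻¹ := by
    have hpi := Real.pi_pos
    have h1 : (2:ℂ)/((Real.pi : ℂ) * z) = ((2 / Real.pi : ℝ) : ℂ) * z⁻¹ := by
      push_cast
      field_simp
    have h2 : (Real.pi : ℂ) / (2*z) = ((Real.pi / 2 : ℝ) : ℂ) * z⁻¹ := by
      push_cast
      field_simp
    have hsq : ∀ w : ℂ, w ≠ 0 → w ^ ((1:ℂ)/2) * w ^ ((1:ℂ)/2) = w := fun w hw => by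
      rw [← Complex.cpow_add _ _ hw]
      norm_num
    have hreal : ∀ a : ℝ, 0 < a →
        (((a : ℝ) : ℂ) * z⁻¹) ^ ((1:ℂ)/2) = (a : ℂ) ^ ((1:ℂ)/2) * (z⁻¹) ^ ((1:ℂ)/2) := by
      intro a ha
      simp only [Complex.cpow_def_of_ne_zero (mul_ne_zero (Complex.ofReal_ne_zero.2 ha.ne')
        (inv_ne_zero h0)), Complex.cpow_def_of_ne_zero (Complex.ofReal_ne_zero.2 ha.ne'),
        Complex.cpow_def_of_ne_zero (inv_ne_zero h0)]
      rw [Complex.log_ofReal_mul ha (inv_ne_zero h0), Complex.ofReal_log ha.le, ← Complex.exp_add]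
      ring_nf
    have hinv : ((2 / Real.pi : ℝ) : ℂ) ^ ((1:ℂ)/2) * ((Real.pi / 2 : ℝ) : ℂ) ^ ((1:ℂ)/2) = 1 := by
      rw [← Complex.mul_cpow_ofReal_nonneg (by positivity) (by positivity), ← Complex.ofReal_mul,
        show 2 / Real.pi * (Real.pi / 2) = 1 by field_simp]
      simp
    rw [h1, h2, hreal _ (by positivity), hreal _ (by positivity), mul_mul_mul_comm, hinv,
      hsq _ (inv_ne_zero h0), one_mul]
  rw [sphk, Khalf, hsum, ← mul_assoc, ← mul_assoc, hroot, ← pow_mul_sum_besselCoeff n h0]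
  field_simp
  ring

theorem deriv_sphk_div (n : ℕ) {z : ℂ} (hz : 0 < z.re) :
    deriv (sphk n) z / sphk n z = -(((n + 1 : ℝ) : ℂ) * z⁻¹ + besselRatio n z / z) := by
  have h0 : z ≠ 0 := by
    rintro rfl
    simp at hz
  have hev : sphk n =ᶠ[𝓝 z]
      fun w => Complex.exp (-w) * (w ^ (n + 1))⁻¹ * reverseBessel n w := by
    filter_upwards [(isOpen_lt continuous_const Complex.continuous_re).mem_nhds hz] with w hw
    exact sphk_eq n hw
  have hd := ((hasDerivAt_neg z).cexp.mul
    ((hasDerivAt_pow (n + 1) z).inv (pow_ne_zero _ h0))).mul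
    (hasDerivAt_reverseBessel n hz.le h0)
  have ht := reverseBessel_ne_zero n hz.le
  have he := Complex.exp_ne_zero (-z)
  rw [hev.deriv_eq, sphk_eq n hz]
  refine (congrArg (· / _) hd.deriv).trans ?_
  simp only [Pi.mul_apply, Pi.inv_apply]
  push_cast
  field_simp
  ring

/-- for `Re z > 0`, both `Re(z k_n'(z)/k_n(z)) ≤ 0` and
`Re(k_n'(z)/k_n(z)) ≤ 0`. -/
theorem stmt_11 (n : ℕ) (z : ℂ) (hz : 0 < z.re) :
    (z * deriv (sphk n) z / sphk n z).re ≤ 0 ∧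
    (deriv (sphk n) z / sphk n z).re ≤ 0 := by
  have h0 : z ≠ 0 := by
    rintro rfl
    simp at hz
  rw [mul_div_assoc, deriv_sphk_div n hz]
  constructor
  · have h : z * -(((n + 1 : ℝ) : ℂ) * z⁻¹ + besselRatio n z / z)
        = -(((n + 1 : ℝ) : ℂ) + besselRatio n z) := by
      field_simp
    rw [h, Complex.neg_re, Complex.add_re, Complex.ofReal_re]
    linarith [neg_le_re_besselRatio n hz.le]
  · rw [Complex.neg_re, Complex.add_re, Complex.re_ofReal_mul, Complex.inv_re]
    have h1 := re_besselRatio_div_pos n hz.le h0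
    have h2 : 0 ≤ (n + 1 : ℝ) * (z.re / Complex.normSq z) := by
      have := Complex.normSq_nonneg z
      positivity
    linarith
end
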